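/- Let P be a fixed subspace of type (l₁,…,l_t) in F_q^{n₁+⋯+n_t}. The number of subspaces of type (k₁,…,k_t) containing P equals q^{∑_{j=1}^{t−1}(k_j−k_{j+1}−l_j+l_{j+1})(n_{j+1}+⋯+n_t−k_{j+1})} · [n_t−l_t choose k_t−l_t]_q · ∏_{j=1}^{t−1} [n_j−l_j+l_{j+1} choose k_j−k_{j+1}−l_j+l_{j+1}]_q, provided 0 ≤ l_i−l_{i+1} ≤ k_i−k_{i+1} ≤ n_i for 1 ≤ i ≤ t−1 and 0 ≤ l_t ≤ k_t ≤ n_t. -/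

import Mathlib

/-- Gaussian binomial coefficient, via the q-Pascal recursion. -/
def gaussBinom (q : ℕ) : ℕ → ℕ → ℕ
  | _, 0 => 1
  | 0, _ + 1 => 0
  | m + 1, i + 1 => gaussBinom q m i + q ^ (i + 1) * gaussBinom q m (i + 1)

/-- The subspace of `F^N` spanned by the standard basis vectors `e_j` with `c ≤ j`. -/
def lastSpan (F : Type) [Field F] (N c : ℕ) : Submodule F (Fin N → F) :=
  Submodule.span F {v | ∃ j : Fin N, c ≤ (j : ℕ) ∧ v = Pi.single j 1}

/-- `P` is a subspace of type `(k 0, k 1, …, k (t-1))` of `F_q^{n 0 + ⋯ + n (t-1)}`. -/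
def IsTypeP (F : Type) [Field F] (t : ℕ) (n k : ℕ → ℕ)
    (P : Submodule F (Fin (∑ m ∈ Finset.range t, n m) → F)) : Prop :=
  Module.finrank F P = k 0 ∧
    ∀ i, 1 ≤ i → i < t →
      Module.finrank F
        ↥(P ⊓ lastSpan F (∑ m ∈ Finset.range t, n m) (∑ j ∈ Finset.range i, n j)) = k i


open Module

theorem gaussBinom_mul_prod (q m d : ℕ) :
    (gaussBinom q m d : ℤ) * ∏ i ∈ Finset.range d, ((q : ℤ) ^ d - (q : ℤ) ^ i) =
      ∏ i ∈ Finset.range d, ((q : ℤ) ^ m - (q : ℤ) ^ i) := by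
  have shift : ∀ m d : ℕ, ∏ i ∈ Finset.range (d + 1), ((q : ℤ) ^ (m + 1) - (q : ℤ) ^ i) =
      ((q : ℤ) ^ (m + 1) - 1) * q ^ d * ∏ i ∈ Finset.range d, ((q : ℤ) ^ m - (q : ℤ) ^ i) := by
    intro m d
    rw [Finset.prod_range_succ', pow_zero, mul_comm, mul_assoc]
    congr 1
    conv_rhs => rw [← Finset.card_range d, ← Finset.prod_const, Finset.card_range,
      ← Finset.prod_mul_distrib]
    exact Finset.prod_congr rfl fun i _ => by ring
  induction m generalizing d with
  | zero =>
    cases d with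
    | zero => simp [gaussBinom]
    | succ d =>
      rw [Finset.prod_range_succ']
      simp [gaussBinom, Finset.prod_range_succ']
  | succ m ih =>
    cases d with
    | zero => simp [gaussBinom]
    | succ d =>
      have h1 := ih d
      have h2 := ih (d + 1)
      rw [Finset.prod_range_succ (fun i => (q : ℤ) ^ m - (q : ℤ) ^ i)] at h2
      rw [gaussBinom, shift m d, Nat.cast_add, Nat.cast_mul, add_mul, mul_assoc, h2, shift d d,
        ← h1]
      push_cast
      ring

/-- A map with finite target all of whose fibres have `c` elements multiplies cardinality by `c`. -/
theorem Nat.card_eq_mul_of_card_fiber {α β : Type*} [Finite α] [Finite β] (f : α → β) (c : ℕ)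
    (hf : ∀ b, Nat.card {a // f a = b} = c) : Nat.card α = Nat.card β * c := by
  have := Fintype.ofFinite β
  rw [← Nat.card_congr (Equiv.sigmaFiberEquiv f), Nat.card_sigma]
  simp [hf]

theorem Submodule.finrank_map_mkQ_add {F V : Type*} [Field F] [AddCommGroup V] [Module F V]
    [FiniteDimensional F V] (S : Submodule F V) {X : Submodule F V} (h : S ≤ X) :
    finrank F (X.map S.mkQ) + finrank F S = finrank F X := by
  have h1 := LinearMap.finrank_range_add_finrank_ker (S.mkQ.domRestrict X)
  rw [LinearMap.range_domRestrict, LinearMap.ker_domRestrict, Submodule.ker_mkQ] at h1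
  rwa [(Submodule.comapSubtypeEquivOfLe h).finrank_eq] at h1

section Counting

variable {F : Type*} [Field F] [Fintype F] {V : Type*} [AddCommGroup V] [Module F V] [Finite V]

theorem card_linearIndependent_mkQ (E : Submodule F V) {d : ℕ} (hd : d ≤ finrank F (V ⧸ E)) :
    Nat.card {s : Fin d → V // LinearIndependent F (E.mkQ ∘ s)} =
      (∏ i ∈ Finset.range d, (Fintype.card F ^ finrank F (V ⧸ E) - Fintype.card F ^ i)) *
        Fintype.card F ^ (d * finrank F E) := by
  have : Finite (V ⧸ E) := Finite.of_surjective _ E.mkQ_surjective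
  have : Fintype E := Fintype.ofFinite E
  rw [Finset.prod_range, ← card_linearIndependent hd]
  refine Nat.card_eq_mul_of_card_fiber
    (fun s => (⟨E.mkQ ∘ s.1, s.2⟩ : {u : Fin d → V ⧸ E // LinearIndependent F u})) _ ?_
  rintro ⟨u, hu⟩
  obtain ⟨s₀, hs₀⟩ : ∃ s₀ : Fin d → V, E.mkQ ∘ s₀ = u :=
    ⟨fun i => Function.surjInv E.mkQ_surjective (u i),
      funext fun i => Function.surjInv_eq E.mkQ_surjective (u i)⟩
  have hadd : ∀ e : Fin d → E, E.mkQ ∘ (fun i => s₀ i + e i) = u := fun e => by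
    rw [← hs₀]; ext i; simp
  have e : (Fin d → E) ≃ {a : {s : Fin d → V // LinearIndependent F (E.mkQ ∘ s)} //
      (⟨E.mkQ ∘ a.1, a.2⟩ : {u : Fin d → V ⧸ E // LinearIndependent F u}) = ⟨u, hu⟩} :=
    { toFun := fun e => ⟨⟨fun i => s₀ i + e i, (hadd e).symm ▸ hu⟩, Subtype.ext (hadd e)⟩
      invFun := fun a i => ⟨a.1.1 i - s₀ i, by
        have h := congrFun ((congrArg Subtype.val a.2).trans hs₀.symm) i
        exact (Submodule.Quotient.eq E).1 h⟩
      left_inv := fun e => by ext i; simp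
      right_inv := fun a => by ext i; simp }
  rw [← Nat.card_congr e, Nat.card_eq_fintype_card, Fintype.card_fun, Fintype.card_fin,
    Module.card_eq_pow_finrank (K := F) (V := E), ← pow_mul, mul_comm]

theorem card_disjoint_subspaces (E : Submodule F V) {d : ℕ} (hd : d ≤ finrank F (V ⧸ E)) :
    Nat.card {Q : Submodule F V // Disjoint Q E ∧ finrank F Q = d} =
      Fintype.card F ^ (d * finrank F E) *
        gaussBinom (Fintype.card F) (finrank F (V ⧸ E)) d := by
  set q := Fintype.card F with hq
  have hq1 : 1 < q := Fintype.one_lt_card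
  have hspan : ∀ s : Fin d → V, LinearIndependent F (E.mkQ ∘ s) →
      Disjoint (Submodule.span F (Set.range s)) E ∧
        finrank F (Submodule.span F (Set.range s)) = d := fun s hs => by
    refine ⟨by simpa using Submodule.range_ker_disjoint hs, ?_⟩
    simpa using finrank_span_eq_card (hs.of_comp E.mkQ)
  have key := Nat.card_eq_mul_of_card_fiber
    (fun s : {s : Fin d → V // LinearIndependent F (E.mkQ ∘ s)} =>
      (⟨_, hspan s.1 s.2⟩ : {Q : Submodule F V // Disjoint Q E ∧ finrank F Q = d}))
    (∏ i ∈ Finset.range d, (q ^ d - q ^ i)) ?_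
  · rw [card_linearIndependent_mkQ E hd] at key
    have cast : ∀ m, d ≤ m → ((∏ i ∈ Finset.range d, (q ^ m - q ^ i) : ℕ) : ℤ) =
        ∏ i ∈ Finset.range d, ((q : ℤ) ^ m - (q : ℤ) ^ i) := fun m hm => by
      rw [Nat.cast_prod]
      refine Finset.prod_congr rfl fun i hi => ?_
      rw [Nat.cast_sub (Nat.pow_le_pow_right hq1.le ((Finset.mem_range.1 hi).le.trans hm))]
      push_cast; rfl
    have hpos : ∏ i ∈ Finset.range d, (q ^ d - q ^ i) ≠ 0 :=
      Finset.prod_ne_zero_iff.2 fun i hi =>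
        (Nat.sub_pos_of_lt (Nat.pow_lt_pow_right hq1 (Finset.mem_range.1 hi))).ne'
    refine Nat.eq_of_mul_eq_mul_right (Nat.pos_of_ne_zero hpos) (key.symm.trans ?_)
    have h := gaussBinom_mul_prod q (finrank F (V ⧸ E)) d
    rw [← cast _ le_rfl, ← cast _ hd] at h
    rw [mul_assoc, show gaussBinom q (finrank F (V ⧸ E)) d * _ = _ from mod_cast h, mul_comm]
  · rintro ⟨Q, hQE, hQ⟩
    rw [Finset.prod_range]
    conv_rhs => rw [← hQ]
    subst hQ
    rw [hq, ← card_linearIndependent (K := F) (V := Q) le_rfl]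
    refine Nat.card_congr
      { toFun := fun a => ⟨fun i => ⟨a.1.1 i, by
            have h := congrArg Subtype.val a.2
            exact h.le (Submodule.subset_span ⟨i, rfl⟩)⟩,
          LinearIndependent.of_comp Q.subtype (a.1.2.of_comp E.mkQ)⟩
        invFun := fun s =>
          have hs : LinearIndependent F (Q.subtype ∘ s.1) := s.2.map' _ Q.ker_subtype
          have hle : Submodule.span F (Set.range (Q.subtype ∘ s.1)) ≤ Q :=
            Submodule.span_le.2 (by rintro _ ⟨i, rfl⟩; exact (s.1 i).2)
          ⟨⟨Q.subtype ∘ s.1, hs.map (by simpa using hQE.mono_left hle)⟩, Subtype.ext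
            (Submodule.eq_of_le_of_finrank_eq hle (by simpa using finrank_span_eq_card hs))⟩
        left_inv := fun a => rfl
        right_inv := fun s => rfl }

theorem card_disjoint_subspaces_le {W E : Submodule F V} (hE : E ≤ W) {d : ℕ}
    (hd : d ≤ finrank F W - finrank F E) :
    Nat.card {Q : Submodule F V // Q ≤ W ∧ Disjoint Q E ∧ finrank F Q = d} =
      Fintype.card F ^ (d * finrank F E) *
        gaussBinom (Fintype.card F) (finrank F W - finrank F E) d := by
  have hfr : finrank F (E.comap W.subtype) = finrank F E :=
    (Submodule.comapSubtypeEquivOfLe hE).finrank_eq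
  have hquot : finrank F (W ⧸ E.comap W.subtype) = finrank F W - finrank F E := by
    have := Submodule.finrank_quotient_add_finrank (E.comap W.subtype)
    omega
  rw [← hquot] at hd ⊢
  rw [← hfr, ← card_disjoint_subspaces _ hd]
  have hdisj : ∀ Q : Submodule F W, Disjoint (Q.map W.subtype) E ↔
      Disjoint Q (E.comap W.subtype) := fun Q => by
    simp only [Submodule.disjoint_def, Submodule.mem_map, Submodule.mem_comap]
    constructor
    · intro h x hx hxE
      exact Subtype.ext (h _ ⟨x, hx, rfl⟩ hxE)
    · rintro h _ ⟨x, hx, rfl⟩ hxE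
      rw [h x hx hxE, map_zero]
  symm
  refine Nat.card_congr
    { toFun := fun Q => ⟨Q.1.map W.subtype, Submodule.map_subtype_le _ _, (hdisj _).2 Q.2.1,
        (Submodule.finrank_map_subtype_eq _ _).trans Q.2.2⟩
      invFun := fun Q =>
        have h : (Q.1.comap W.subtype).map W.subtype = Q.1 := by
          rw [Submodule.map_comap_subtype, inf_eq_right.2 Q.2.1]
        ⟨Q.1.comap W.subtype, (hdisj _).1 (h.symm ▸ Q.2.2.1), by
          rw [← Submodule.finrank_map_subtype_eq, h, Q.2.2.2]⟩
      left_inv := fun Q => Subtype.ext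
        (Submodule.comap_map_eq_of_injective W.injective_subtype Q.1)
      right_inv := fun Q => Subtype.ext (by
        simp [Submodule.map_comap_subtype, Q.2.1]) }

theorem card_subspaces_inf_eq {W E P R : Submodule F V} (hE : E ≤ W) (hP : P ≤ W) (hR : R ≤ E)
    (hPR : P ⊓ E ≤ R) {r : ℕ} (hr : finrank F ↥(P ⊔ R) ≤ r)
    (hd : r - finrank F ↥(P ⊔ R) ≤ finrank F W - finrank F ↥(E ⊔ P)) :
    Nat.card {Q : Submodule F V // Q ≤ W ∧ P ≤ Q ∧ Q ⊓ E = R ∧ finrank F Q = r} =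
      Fintype.card F ^ ((r - finrank F ↥(P ⊔ R)) * (finrank F E - finrank F R)) *
        gaussBinom (Fintype.card F) (finrank F W - finrank F ↥(E ⊔ P))
          (r - finrank F ↥(P ⊔ R)) := by
  have : Finite (V ⧸ (P ⊔ R)) := Finite.of_surjective _ (P ⊔ R).mkQ_surjective
  set S := P ⊔ R with hS
  set T := E ⊔ P with hT
  have hST : S ≤ T := sup_le le_sup_right (hR.trans le_sup_left)
  have hTW : T ≤ W := sup_le hE hP
  have fT := S.finrank_map_mkQ_add hST
  have fW := S.finrank_map_mkQ_add (hST.trans hTW)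
  have hPE : P ⊓ E = P ⊓ R := le_antisymm (le_inf inf_le_left hPR) (inf_le_inf_left _ hR)
  have s1 := Submodule.finrank_sup_add_finrank_inf_eq P R
  have s2 := Submodule.finrank_sup_add_finrank_inf_eq P E
  rw [hPE, sup_comm, ← hT] at s2
  have hRE := Submodule.finrank_mono hR
  have e1 : finrank F W - finrank F T = finrank F (W.map S.mkQ) - finrank F (T.map S.mkQ) := by
    omega
  have e2 : finrank F E - finrank F R = finrank F (T.map S.mkQ) := by
    rw [← hS] at s1
    omega
  rw [e1] at hd ⊢
  rw [e2, ← card_disjoint_subspaces_le (Submodule.map_mono hTW) hd]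
  have hback : ∀ {X : Submodule F V}, S ≤ X → (X.map S.mkQ).comap S.mkQ = X := fun h => by
    rw [Submodule.comap_map_mkQ, sup_eq_right.2 h]
  have hinj := Submodule.comap_injective_of_surjective S.mkQ_surjective
  have hforth : ∀ Y : Submodule F (V ⧸ S), (Y.comap S.mkQ).map S.mkQ = Y :=
    Submodule.map_comap_eq_of_surjective S.mkQ_surjective
  have hinf : ∀ {X : Submodule F V}, P ≤ X → (X ⊓ E = R ↔ X ⊓ T = S) := fun {X} hPX => by
    rw [hT, hS, ← inf_sup_assoc_of_le E hPX]
    constructor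
    · rintro rfl
      rw [sup_comm]
    · intro h
      refine le_antisymm ?_ (le_inf ?_ hR)
      · calc X ⊓ E ≤ (R ⊔ P) ⊓ E :=
              le_inf ((le_sup_left.trans h.le).trans_eq (sup_comm _ _)) inf_le_right
          _ = R ⊔ P ⊓ E := sup_inf_assoc_of_le P hR
          _ ≤ R := sup_le le_rfl hPR
      · exact (le_sup_right.trans h.ge).trans (sup_le inf_le_left hPX)
  have hdisj : ∀ {X : Submodule F V}, S ≤ X →
      (Disjoint (X.map S.mkQ) (T.map S.mkQ) ↔ X ⊓ T = S) := fun {X} hSX => by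
    rw [disjoint_iff, ← hinj.eq_iff, Submodule.comap_inf, hback hSX, hback hST,
      Submodule.comap_bot, Submodule.ker_mkQ]
  have hSQ : ∀ {Q : Submodule F V}, P ≤ Q → Q ⊓ E = R → S ≤ Q := fun h1 h2 =>
    sup_le h1 (h2 ▸ inf_le_left)
  refine Nat.card_congr
    { toFun := fun Q => ⟨Q.1.map S.mkQ, ?_, ?_, ?_⟩
      invFun := fun Y => ⟨Y.1.comap S.mkQ, ?_, ?_, ?_, ?_⟩
      left_inv := fun Q => Subtype.ext (hback (hSQ Q.2.2.1 Q.2.2.2.1))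
      right_inv := fun Y => Subtype.ext (hforth Y.1) }
  · exact Submodule.map_mono Q.2.1
  · exact (hdisj (hSQ Q.2.2.1 Q.2.2.2.1)).2 ((hinf Q.2.2.1).1 Q.2.2.2.1)
  · have := S.finrank_map_mkQ_add (hSQ Q.2.2.1 Q.2.2.2.1)
    have := Q.2.2.2.2
    omega
  all_goals
    have hSY : S ≤ Y.1.comap S.mkQ := Submodule.le_comap_mkQ S Y.1
    have hPY : P ≤ Y.1.comap S.mkQ := le_sup_left.trans hSY
  · exact (Submodule.comap_mono Y.2.1).trans_eq (hback (hST.trans hTW))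
  · exact hPY
  · rw [hinf hPY, ← hdisj hSY, hforth]
    exact Y.2.2.1
  · have := S.finrank_map_mkQ_add hSY
    rw [hforth, Y.2.2.2] at this
    omega

theorem card_subspaces_flag {E : ℕ → Submodule F V} (hE : Antitone E) {T : ℕ} {n k l : ℕ → ℕ}
    (hn : ∀ i ≤ T, finrank F (E i) = ∑ m ∈ Finset.Ico i (T + 1), n m)
    (h : ∀ i < T, l (i + 1) ≤ l i ∧ l i - l (i + 1) ≤ k i - k (i + 1) ∧
      k (i + 1) ≤ k i ∧ k i - k (i + 1) ≤ n i)
    (hlast : l T ≤ k T ∧ k T ≤ n T) {P : Submodule F V}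
    (hP : ∀ i ≤ T, finrank F ↥(P ⊓ E i) = l i) {i : ℕ} (hi : i ≤ T) :
    Nat.card {Q : Submodule F V // Q ≤ E i ∧ P ⊓ E i ≤ Q ∧
        ∀ j, i ≤ j → j ≤ T → finrank F ↥(Q ⊓ E j) = k j} =
      Fintype.card F ^ (∑ j ∈ Finset.Ico i T, ((k j - k (j + 1)) - (l j - l (j + 1))) *
          ((∑ m ∈ Finset.Ico (j + 1) (T + 1), n m) - k (j + 1))) *
        gaussBinom (Fintype.card F) (n T - l T) (k T - l T) *
        ∏ j ∈ Finset.Ico i T, gaussBinom (Fintype.card F) (n j - (l j - l (j + 1)))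
          ((k j - k (j + 1)) - (l j - l (j + 1))) := by
  induction hi using Nat.decreasingInduction with
  | of_succ i hiT ih =>
    obtain ⟨h1, h2, h3, h4⟩ := h i hiT
    have hEi : E (i + 1) ≤ E i := hE (Nat.le_succ i)
    have hPi : P ⊓ E i ⊓ E (i + 1) = P ⊓ E (i + 1) := by rw [inf_assoc, inf_eq_right.2 hEi]
    have fPi := hP i hiT.le
    have fPi' := hP (i + 1) hiT
    have fE := hn i hiT.le
    have fE' := hn (i + 1) hiT
    rw [Finset.sum_eq_sum_Ico_succ_bot (by omega), ← fE'] at fE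
    rw [Finset.sum_eq_sum_Ico_succ_bot hiT, Finset.prod_eq_prod_Ico_succ_bot hiT]
    have key := Nat.card_eq_mul_of_card_fiber
      (α := {Q : Submodule F V // Q ≤ E i ∧ P ⊓ E i ≤ Q ∧
        ∀ j, i ≤ j → j ≤ T → finrank F ↥(Q ⊓ E j) = k j})
      (β := {Q : Submodule F V // Q ≤ E (i + 1) ∧ P ⊓ E (i + 1) ≤ Q ∧
        ∀ j, i + 1 ≤ j → j ≤ T → finrank F ↥(Q ⊓ E j) = k j})
      (fun Q => ⟨Q.1 ⊓ E (i + 1), inf_le_right,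
        le_inf ((inf_le_inf_left P hEi).trans Q.2.2.1) inf_le_right, fun j hj hjT => by
          rw [inf_assoc, inf_eq_right.2 (hE hj), Q.2.2.2 j (by omega) hjT]⟩)
      (Fintype.card F ^ (((k i - k (i + 1)) - (l i - l (i + 1))) *
          (finrank F (E (i + 1)) - k (i + 1))) *
        gaussBinom (Fintype.card F) (n i - (l i - l (i + 1)))
          ((k i - k (i + 1)) - (l i - l (i + 1)))) ?_
    · rw [key, ih, ← fE', pow_add]
      ring
    · rintro ⟨R, hRE, hPR, hR⟩
      have fR := hR (i + 1) le_rfl hiT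
      rw [inf_eq_left.2 hRE] at fR
      have hPR' : P ⊓ E i ⊓ R = P ⊓ E (i + 1) :=
        le_antisymm (hPi ▸ inf_le_inf_left _ hRE) (le_inf (inf_le_inf_left P hEi) hPR)
      have s1 := Submodule.finrank_sup_add_finrank_inf_eq (P ⊓ E i) R
      have s2 := Submodule.finrank_sup_add_finrank_inf_eq (E (i + 1)) (P ⊓ E i)
      rw [hPR'] at s1
      rw [inf_comm (E (i + 1)), hPi] at s2
      have d1 : k i - finrank F ↥(P ⊓ E i ⊔ R) = (k i - k (i + 1)) - (l i - l (i + 1)) := by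
        omega
      have d2 : finrank F (E i) - finrank F ↥(E (i + 1) ⊔ P ⊓ E i) =
          n i - (l i - l (i + 1)) := by
        omega
      rw [← d1, ← d2, ← fR,
        ← card_subspaces_inf_eq hEi inf_le_right hRE (hPi.le.trans hPR) (by omega) (by omega)]
      refine Nat.card_congr
        { toFun := fun a => ⟨a.1.1, a.1.2.1, a.1.2.2.1, congrArg Subtype.val a.2, by
            rw [← a.1.2.2.2 i le_rfl hiT.le, inf_eq_left.2 a.1.2.1]⟩
          invFun := fun Q => ⟨⟨Q.1, Q.2.1, Q.2.2.1, fun j hj hjT => ?_⟩,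
            Subtype.ext Q.2.2.2.1⟩
          left_inv := fun _ => rfl
          right_inv := fun _ => rfl }
      rcases hj.eq_or_lt with rfl | hj
      · rw [inf_eq_left.2 Q.2.1, Q.2.2.2.2]
      · rw [← hR j hj hjT]
        conv_rhs => rw [← Q.2.2.2.1, inf_assoc, inf_eq_right.2 (hE hj)]
  | self =>
    have fP := hP T le_rfl
    have fE := hn T le_rfl
    rw [Nat.Ico_succ_singleton, Finset.sum_singleton] at fE
    have key := card_subspaces_inf_eq (W := E T) (E := ⊥) (P := P ⊓ E T) (R := ⊥) bot_le
      inf_le_right le_rfl (by simp) (r := k T)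
      (by rw [sup_bot_eq]; omega) (by rw [sup_bot_eq, bot_sup_eq]; omega)
    rw [sup_bot_eq, bot_sup_eq, fP, fE, finrank_bot, Nat.sub_zero, mul_zero, pow_zero,
      one_mul] at key
    simp only [inf_bot_eq, true_and] at key
    simp only [Finset.Ico_self, Finset.sum_empty, Finset.prod_empty, pow_zero, one_mul, mul_one]
    rw [← key]
    refine Nat.card_congr (Equiv.subtypeEquivRight fun Q => and_congr_right fun hQ =>
      and_congr_right fun _ => ⟨fun h => ?_, fun h j hj hjT => ?_⟩)
    · rw [← h T le_rfl le_rfl, inf_eq_left.2 hQ]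
    · obtain rfl := le_antisymm hjT hj
      rwa [inf_eq_left.2 hQ]

end Counting

theorem finrank_lastSpan (F : Type) [Field F] (N c : ℕ) : finrank F (lastSpan F N c) = N - c := by
  have hset : {v : Fin N → F | ∃ j : Fin N, c ≤ (j : ℕ) ∧ v = Pi.single j 1} =
      Set.range fun j : {j : Fin N // c ≤ (j : ℕ)} => (Pi.single j.1 1 : Fin N → F) := by
    ext v
    simp [eq_comm]
  have hli : LinearIndependent F
      fun j : {j : Fin N // c ≤ (j : ℕ)} => (Pi.single j.1 1 : Fin N → F) := by
    simpa [Function.comp_def] using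
      (Pi.basisFun F (Fin N)).linearIndependent.comp _ Subtype.val_injective
  rw [lastSpan, hset, finrank_span_eq_card hli, Fintype.card_subtype,
    ← Finset.card_map Fin.valEmbedding, ← Nat.card_Ico]
  congr 1
  ext x
  simp only [Finset.mem_map, Finset.mem_filter_univ, Fin.valEmbedding_apply, Finset.mem_Ico]
  exact ⟨by rintro ⟨j, hj, rfl⟩; exact ⟨hj, j.2⟩, fun ⟨h1, h2⟩ => ⟨⟨x, h2⟩, h1, rfl⟩⟩

theorem lastSpan_anti (F : Type) [Field F] (N : ℕ) : Antitone (lastSpan F N) := fun _ _ h =>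
  Submodule.span_mono fun _ ⟨j, hj, hv⟩ => ⟨j, h.trans hj, hv⟩

/-- The number of subspaces of type `(k 0, …, k (t-1))` containing a fixed subspace `P`
of type `(l 0, …, l (t-1))`. -/
theorem stmt10 {F : Type} [Field F] [Fintype F] (q t : ℕ) (ht : 1 ≤ t) (n k l : ℕ → ℕ)
    (hq : Fintype.card F = q)
    (h : ∀ i < t - 1, l (i + 1) ≤ l i ∧ l i - l (i + 1) ≤ k i - k (i + 1) ∧
      k (i + 1) ≤ k i ∧ k i - k (i + 1) ≤ n i)
    (hlast : l (t - 1) ≤ k (t - 1) ∧ k (t - 1) ≤ n (t - 1))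
    (P : Submodule F (Fin (∑ m ∈ Finset.range t, n m) → F)) (hP : IsTypeP F t n l P) :
    Nat.card {Q : Submodule F (Fin (∑ m ∈ Finset.range t, n m) → F) //
        IsTypeP F t n k Q ∧ P ≤ Q} =
      q ^ (∑ j ∈ Finset.range (t - 1),
          ((k j - k (j + 1)) - (l j - l (j + 1))) *
            ((∑ m ∈ Finset.Ico (j + 1) t, n m) - k (j + 1))) *
        gaussBinom q (n (t - 1) - l (t - 1)) (k (t - 1) - l (t - 1)) *
        ∏ j ∈ Finset.range (t - 1),
          gaussBinom q (n j - (l j - l (j + 1))) ((k j - k (j + 1)) - (l j - l (j + 1))) := by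
  obtain ⟨T, rfl⟩ : ∃ T, t = T + 1 := ⟨t - 1, by omega⟩
  subst hq
  simp only [Nat.add_sub_cancel] at h hlast ⊢
  let E : ℕ → Submodule F (Fin (∑ m ∈ Finset.range (T + 1), n m) → F) := fun i =>
    lastSpan F _ (∑ j ∈ Finset.range i, n j)
  have hE : Antitone E := fun i j hij => lastSpan_anti F _
    (Finset.sum_le_sum_of_subset (Finset.range_subset_range.2 hij))
  have hn : ∀ i ≤ T, finrank F (E i) = ∑ m ∈ Finset.Ico i (T + 1), n m := fun i hi => by
    have := Finset.sum_range_add_sum_Ico n (show i ≤ T + 1 by omega)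
    rw [finrank_lastSpan]
    omega
  have hE0 : E 0 = ⊤ := Submodule.eq_top_of_finrank_eq (by rw [finrank_lastSpan]; simp)
  have htype : ∀ (k : ℕ → ℕ) (Q : Submodule F _), IsTypeP F (T + 1) n k Q ↔
      ∀ i ≤ T, finrank F ↥(Q ⊓ E i) = k i := fun k Q => by
    constructor
    · rintro ⟨h0, h1⟩ i hi
      rcases Nat.eq_zero_or_pos i with rfl | hi0
      · rwa [hE0, inf_top_eq]
      · exact h1 i hi0 (by omega)
    · intro h
      refine ⟨?_, fun i _ hi => h i (by omega)⟩
      rw [← h 0 (Nat.zero_le T), hE0, inf_top_eq]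
  have key := card_subspaces_flag hE hn h hlast ((htype l P).1 hP) (Nat.zero_le T)
  simp only [← Finset.range_eq_Ico] at key
  rw [← key]
  refine Nat.card_congr (Equiv.subtypeEquivRight fun Q => ?_)
  rw [htype, hE0]
  simp [and_comm]
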